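/- Let G be a finite abelian group, A a commutative ring, and B a commutative A-algebra equipped with an action of G by A-algebra automorphisms. Assume: (i) A maps isomorphically onto the subring B^G of G-invariants; (ii) B is faithfully flat as an A-module; and (iii) the A-algebra homomorphism B ⊗_A B → (G → B) defined by x ⊗ y ↦ (g ↦ x · (g·y)) is bijective (i.e. B is a G-torsor over A). For a group homomorphism χ : G → Aˣ, let B_χ = {b ∈ B : g·b = χ(g)b for all g ∈ G}, an A-submodule of B. Then for any group homomorphisms χ₁, …, χ_m : G → Aˣ, the A-linear map B_{χ₁} ⊗_A ⋯ ⊗_A B_{χ_m} → B_{χ₁⋯χ_m} induced by multiplication in B is an isomorphism. -/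

import Mathlib

open scoped TensorProduct

section Torsor

variable (G : Type*) [CommGroup G] [Fintype G]
variable (A : Type*) [CommRing A]
variable (B : Type*) [CommRing B] [Algebra A B]
variable [MulSemiringAction G B] [SMulCommClass G A B]

/-- The `A`-algebra homomorphism `B ⊗_A B → (G → B)`, `x ⊗ y ↦ (g ↦ x·(g·y))`
(as an `A`-linear map). -/
noncomputable def torsorComparisonMap : B ⊗[A] B →ₗ[A] (G → B) :=
  TensorProduct.lift
    (LinearMap.mk₂ A (fun x y => fun g : G => x * (g • y))
      (fun x x' y => by funext g; simp [add_mul])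
      (fun a x y => by funext g; simp [Pi.smul_apply, smul_mul_assoc])
      (fun x y y' => by funext g; simp [smul_add, mul_add])
      (fun a x y => by
        funext g
        simp only [Pi.smul_apply]
        rw [smul_comm g a y, mul_smul_comm]))

/-- For a character `χ : G → Aˣ`, the resolvent module
`B_χ = {b ∈ B : g·b = χ(g)b for all g ∈ G}`, an `A`-submodule of `B`. -/
def resolventModule (χ : G →* Aˣ) : Submodule A B where
  carrier := {b | ∀ g : G, g • b = ((χ g : A)) • b}
  add_mem' := fun {x y} hx hy g => by rw [smul_add, hx g, hy g, smul_add]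
  zero_mem' := fun g => by simp
  smul_mem' := fun a b hb g => by rw [smul_comm, hb g, smul_comm]

/-- The `A`-linear map `B_{χ₁} ⊗_A ⋯ ⊗_A B_{χ_m} → B` induced by multiplication
in `B` (its image lies in `B_{χ₁⋯χ_m}`). -/
noncomputable def resolventMultiplication {m : ℕ} (χ : Fin m → (G →* Aˣ)) :
    (⨂[A] i : Fin m, (resolventModule G A B (χ i))) →ₗ[A] B :=
  PiTensorProduct.lift
    ((MultilinearMap.mkPiAlgebra A (Fin m) B).compLinearMap
      (fun i => (resolventModule G A B (χ i)).subtype))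

theorem aux_avg_mem (χ : G →* Aˣ) (b : B) :
    (∑ g : G, ((χ g)⁻¹ : Aˣ).val • (g • b)) ∈ resolventModule G A B χ := by
  intro h
  rw [Finset.smul_sum, Finset.smul_sum]
  refine Fintype.sum_equiv (Equiv.mulLeft h) _ _ (fun g => ?_)
  rw [smul_comm h, Equiv.coe_mulLeft, smul_smul, smul_smul, map_mul, mul_inv, Units.val_mul,
    ← mul_assoc, Units.mul_inv, one_mul]

theorem aux_mem_iff (χ : G →* Aˣ) (b : B) :
    b ∈ resolventModule G A B χ ↔ ∀ g : G, g • b = ((χ g : A)) • b := Iff.rfl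

theorem aux_mul_mem (χ ψ : G →* Aˣ) {b c : B} (hb : b ∈ resolventModule G A B χ)
    (hc : c ∈ resolventModule G A B ψ) : b * c ∈ resolventModule G A B (χ * ψ) := by
  intro g
  rw [smul_mul', hb g, hc g, smul_mul_smul_comm]
  simp

theorem aux_one_mem : (1 : B) ∈ resolventModule G A B 1 := by
  intro g
  simp

theorem aux_prod_mem {ι : Type*} (s : Finset ι) (χ : ι → (G →* Aˣ)) (b : ι → B)
    (hb : ∀ i, b i ∈ resolventModule G A B (χ i)) :
    ∏ i ∈ s, b i ∈ resolventModule G A B (∏ i ∈ s, χ i) := by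
  classical
  induction s using Finset.induction_on with
  | empty => simpa using aux_one_mem G A B
  | insert i s hi ih =>
    rw [Finset.prod_insert hi, Finset.prod_insert hi]
    exact aux_mul_mem G A B _ _ (hb i) ih

theorem aux_span (htorsor : Function.Surjective (torsorComparisonMap G A B)) (χ : G →* Aˣ) :
    (1 : B) ∈ Ideal.span (resolventModule G A B χ : Set B) := by
  classical
  have key : ∀ t : B ⊗[A] B, (∑ g : G, ((χ g)⁻¹ : Aˣ).val • torsorComparisonMap G A B t g) ∈
      Ideal.span (resolventModule G A B χ : Set B) := by
    intro t
    induction t using TensorProduct.induction_on with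
    | zero => simp
    | tmul x y =>
      have : (∑ g : G, ((χ g)⁻¹ : Aˣ).val • torsorComparisonMap G A B (x ⊗ₜ y) g) =
          x * ∑ g : G, ((χ g)⁻¹ : Aˣ).val • (g • y) := by
        rw [Finset.mul_sum]
        refine Finset.sum_congr rfl fun g _ => ?_
        rw [mul_smul_comm]
        rfl
      rw [this]
      exact Ideal.mul_mem_left _ _ (Ideal.subset_span (aux_avg_mem G A B χ y))
    | add x y hx hy =>
      simp only [map_add, Pi.add_apply, smul_add, Finset.sum_add_distrib]
      exact add_mem hx hy
  obtain ⟨t, ht⟩ := htorsor (Pi.single 1 1)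
  have h := key t
  rw [ht, Finset.sum_eq_single 1] at h
  · simpa using h
  · intro g _ hg
    simp [Pi.single_eq_of_ne hg]
  · simp

theorem aux_fixed (hinv₂ : Set.range (algebraMap A B) = {b : B | ∀ g : G, g • b = b})
    {b : B} (hb : b ∈ resolventModule G A B 1) : ∃ a : A, algebraMap A B a = b := by
  have : b ∈ {b : B | ∀ g : G, g • b = b} := fun g => by simpa using hb g
  rw [← hinv₂] at this
  exact this

theorem aux_trace (hinv₂ : Set.range (algebraMap A B) = {b : B | ∀ g : G, g • b = b})
    (hflat : Module.FaithfullyFlat A B)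
    (htorsor : Function.Surjective (torsorComparisonMap G A B)) :
    ∃ c : B, ∑ g : G, g • c = 1 := by
  classical
  let Tr : B →ₗ[A] B := ∑ g : G, DistribSMul.toLinearMap A B g
  have hTr : ∀ b, Tr b = ∑ g : G, g • b := fun b => by simp [Tr, LinearMap.sum_apply]
  let J : Ideal A := Submodule.comap (Algebra.linearMap A B) (LinearMap.range Tr)
  have key : ∀ t : B ⊗[A] B, (∑ g : G, torsorComparisonMap G A B t g) ∈
      J.map (algebraMap A B) := by
    intro t
    induction t using TensorProduct.induction_on with
    | zero => simp
    | tmul x y =>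
      have : (∑ g : G, torsorComparisonMap G A B (x ⊗ₜ y) g) = x * ∑ g : G, (g • y) := by
        rw [Finset.mul_sum]
        rfl
      rw [this]
      refine Ideal.mul_mem_left _ _ ?_
      obtain ⟨a, ha⟩ := aux_fixed G A B hinv₂ (b := ∑ g : G, (g • y))
        (by simpa using aux_avg_mem G A B 1 y)
      rw [← ha]
      refine Ideal.mem_map_of_mem _ ?_
      exact ⟨y, by rw [hTr, ← ha]; rfl⟩
    | add x y hx hy =>
      simp only [map_add, Pi.add_apply, Finset.sum_add_distrib]
      exact add_mem hx hy
  obtain ⟨t, ht⟩ := htorsor (Pi.single 1 1)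
  have h := key t
  rw [ht, Finset.sum_pi_single' ] at h
  have h1 : (1 : A) ∈ (J.map (algebraMap A B)).comap (algebraMap A B) := by
    simpa using h
  rw [Ideal.comap_map_eq_self_of_faithfullyFlat] at h1
  obtain ⟨c, hc⟩ := h1
  exact ⟨c, by rw [← hTr, hc]; simp⟩

theorem aux_dual (hinv₂ : Set.range (algebraMap A B) = {b : B | ∀ g : G, g • b = b})
    (hflat : Module.FaithfullyFlat A B)
    (htorsor : Function.Surjective (torsorComparisonMap G A B)) (χ : G →* Aˣ) :
    ∃ (ι : Type) (_ : Fintype ι) (x y : ι → B), (∀ i, x i ∈ resolventModule G A B χ) ∧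
      (∀ i, y i ∈ resolventModule G A B χ⁻¹) ∧ ∑ i, x i * y i = 1 := by
  obtain ⟨c, hc⟩ := aux_trace G A B hinv₂ hflat htorsor
  have h1 : ∀ z ∈ Ideal.span (resolventModule G A B χ : Set B), ∀ c : B,
      (∑ g : G, g • (c * z)) ∈ resolventModule G A B χ * resolventModule G A B χ⁻¹ := by
    intro z hz
    induction hz using Submodule.span_induction with
    | mem w hw =>
      intro c
      have : (∑ g : G, g • (c * w)) = w * ∑ g : G, ((χ⁻¹ g)⁻¹ : Aˣ).val • (g • c) := by
        rw [Finset.mul_sum]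
        refine Finset.sum_congr rfl fun g _ => ?_
        rw [smul_mul', hw g]
        simp [mul_comm]
      rw [this]
      exact Submodule.mul_mem_mul hw (aux_avg_mem G A B χ⁻¹ c)
    | zero => simp
    | add x y _ _ hx hy =>
      intro c
      simp only [mul_add, smul_add, Finset.sum_add_distrib]
      exact add_mem (hx c) (hy c)
    | smul a x _ hx =>
      intro c
      have := hx (c * a)
      rwa [mul_assoc] at this
  have h2 := h1 1 (aux_span G A B htorsor χ) c
  rw [mul_one, hc] at h2
  generalize (1 : B) = e at h2 ⊢
  induction h2 using Submodule.mul_induction_on' with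
  | mem_mul_mem m hm n hn =>
    exact ⟨Unit, inferInstance, fun _ => m, fun _ => n, fun _ => hm, fun _ => hn, by simp⟩
  | add x _ y _ hx hy =>
    obtain ⟨ι, _, a, b, ha, hb, e⟩ := hx
    obtain ⟨κ, _, a', b', ha', hb', e'⟩ := hy
    refine ⟨ι ⊕ κ, inferInstance, Sum.elim a a', Sum.elim b b', ?_, ?_, ?_⟩
    · rintro (i | i) <;> simp [ha, ha']
    · rintro (i | i) <;> simp [hb, hb']
    · simp [Fintype.sum_sum_type, e, e']

/-- Let `G` be a finite abelian group acting on a commutative `A`-algebra `B` by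
`A`-algebra automorphisms. Assume (i) `A` maps isomorphically onto `B^G`,
(ii) `B` is faithfully flat over `A`, and (iii) `B ⊗_A B → (G → B)`,
`x ⊗ y ↦ (g ↦ x·(g·y))`, is bijective (`B` is a `G`-torsor over `A`). Then for any
characters `χ₁, …, χ_m : G → Aˣ` the `A`-linear map
`B_{χ₁} ⊗_A ⋯ ⊗_A B_{χ_m} → B_{χ₁⋯χ_m}` induced by multiplication is an
isomorphism: it is injective with image exactly `B_{χ₁⋯χ_m}`. -/
theorem resolvent_multiplication_bijective
    (hinv₁ : Function.Injective (algebraMap A B))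
    (hinv₂ : Set.range (algebraMap A B) = {b : B | ∀ g : G, g • b = b})
    (hflat : Module.FaithfullyFlat A B)
    (htorsor : Function.Bijective (torsorComparisonMap G A B))
    (m : ℕ) (χ : Fin m → (G →* Aˣ)) :
    Function.Injective (resolventMultiplication G A B χ) ∧
      LinearMap.range (resolventMultiplication G A B χ) =
        resolventModule G A B (∏ i, χ i) := by
  classical
  choose ι hι x y hx hy hxy using fun i => aux_dual G A B hinv₂ hflat htorsor.2 (χ i)
  have hmul : ∀ u : (i : Fin m) → resolventModule G A B (χ i),
      resolventMultiplication G A B χ (PiTensorProduct.tprod A u) = ∏ i, (u i : B) := by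
    intro u
    simp [resolventMultiplication]
  have hsum1 : ∑ k : (i : Fin m) → ι i, ∏ i, (x i (k i) * y i (k i)) = 1 := by
    have := Fintype.prod_sum (fun i j => x i j * y i j)
    rw [← this]
    simp [hxy]
  have hrange : ∀ t, resolventMultiplication G A B χ t ∈ resolventModule G A B (∏ i, χ i) := by
    intro t
    induction t using PiTensorProduct.induction_on with
    | smul_tprod r u =>
      rw [map_smul, hmul]
      exact Submodule.smul_mem _ _ (aux_prod_mem G A B _ _ _ fun i => (u i).2)
    | add s t hs ht =>
      rw [map_add]
      exact add_mem hs ht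
  let X : ((i : Fin m) → ι i) → ⨂[A] i : Fin m, (resolventModule G A B (χ i)) := fun k =>
    PiTensorProduct.tprod A (fun i => (⟨x i (k i), hx i (k i)⟩ : resolventModule G A B (χ i)))
  have hcoef : ∀ (k : (i : Fin m) → ι i) (z : B), z ∈ resolventModule G A B (∏ i, χ i) →
      ∃ a : A, algebraMap A B a = (∏ i, y i (k i)) * z := by
    intro k z hz
    refine aux_fixed G A B hinv₂ ?_
    have := aux_mul_mem G A B _ _
      (aux_prod_mem G A B Finset.univ (fun i => (χ i)⁻¹) (fun i => y i (k i))
        fun i => hy i (k i)) hz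
    have e : (∏ i, (χ i)⁻¹) * ∏ i, χ i = 1 := by
      rw [← Finset.prod_mul_distrib]
      refine Finset.prod_eq_one fun i _ => ?_
      refine MonoidHom.ext fun g => ?_
      rw [MonoidHom.mul_apply, MonoidHom.inv_apply, inv_mul_cancel, MonoidHom.one_apply]
    rwa [e] at this
  have hrec : ∀ t (a : ((i : Fin m) → ι i) → A),
      (∀ k, algebraMap A B (a k) = (∏ i, y i (k i)) * resolventMultiplication G A B χ t) →
      ∑ k, a k • X k = t := by
    intro t
    induction t using PiTensorProduct.induction_on with
    | smul_tprod r u =>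
      intro a ha
      have hc : ∀ i (j : ι i), ∃ c : A, algebraMap A B c = y i j * u i := by
        intro i j
        refine aux_fixed G A B hinv₂ ?_
        have := aux_mul_mem G A B _ _ (hy i j) (u i).2
        have e : (χ i)⁻¹ * χ i = 1 := by
          refine MonoidHom.ext fun g => ?_
          rw [MonoidHom.mul_apply, MonoidHom.inv_apply, inv_mul_cancel, MonoidHom.one_apply]
        rwa [e] at this
      choose c hc using hc
      have hu : u = fun i => ∑ j, c i j • (⟨x i j, hx i j⟩ : resolventModule G A B (χ i)) := by
        funext i
        apply Subtype.ext
        simp only [AddSubmonoidClass.coe_finsetSum, Submodule.coe_smul]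
        calc (u i : B) = (∑ j, x i j * y i j) * u i := by rw [hxy, one_mul]
          _ = _ := by
            rw [Finset.sum_mul]
            refine Finset.sum_congr rfl fun j _ => ?_
            rw [Algebra.smul_def, hc]
            ring
      have ha' : ∀ k, a k = r * ∏ i, c i (k i) := by
        intro k
        apply hinv₁
        rw [ha, map_smul, hmul, map_mul, map_prod, Algebra.smul_def]
        simp only [hc, Finset.prod_mul_distrib]
        ring
      conv_rhs => rw [hu]
      rw [MultilinearMap.map_sum, Finset.smul_sum]
      refine Finset.sum_congr rfl fun k _ => ?_
      rw [MultilinearMap.map_smul_univ, ha', mul_smul]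
    | add s t hs ht =>
      intro a ha
      choose a1 h1 using fun k => hcoef k _ (hrange s)
      choose a2 h2 using fun k => hcoef k _ (hrange t)
      have : ∀ k, a k = a1 k + a2 k := by
        intro k
        apply hinv₁
        rw [ha, map_add, map_add, h1, h2, mul_add]
      simp only [this, add_smul, Finset.sum_add_distrib]
      rw [hs a1 h1, ht a2 h2]
  constructor
  · rw [injective_iff_map_eq_zero]
    intro t ht
    rw [← hrec t (fun _ => 0) (fun k => by simp [ht])]
    simp
  · apply le_antisymm
    · rintro _ ⟨t, rfl⟩
      exact hrange t
    · intro z hz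
      choose a ha using fun k => hcoef k z hz
      refine ⟨∑ k, a k • X k, ?_⟩
      rw [map_sum]
      calc _ = ∑ k : (i : Fin m) → ι i, (∏ i, (x i (k i) * y i (k i))) * z := by
            refine Finset.sum_congr rfl fun k _ => ?_
            rw [map_smul, hmul, Algebra.smul_def, ha, Finset.prod_mul_distrib]
            ring
        _ = z := by rw [← Finset.sum_mul, hsum1, one_mul]
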